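/- Let m > 0, v ∈ ℝ³, v⁰ = √(m² + ‖v‖²), v̂ = v/v⁰, and let ω ∈ ℝ³ be a unit vector. Then ‖ω − ((v̂·ω)/(1 + v̂·ω))·(ω + v̂)‖ ≤ 2√(m² + ‖v‖²)/m. (Componentwise, this is the vector with i-th entry (δ_{ij} − (ω_i + v̂_i)v̂_j/(1 + v̂·ω))ω^j, summed over j.) -/

import Mathlib

noncomputable section

local notation "⟪" x ", " y "⟫" => @inner ℝ _ _ x y

/-- With `v⁰ = √(m² + ‖v‖²)`, `v̂ = v/v⁰` and `ω` a unit vector, the kernel of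
the initial-data (b1) terms satisfies
`‖ω − ((v̂·ω)/(1 + v̂·ω))·(ω + v̂)‖ ≤ 2√(m² + ‖v‖²)/m`. -/
theorem b1_kernel_bound
    (m : ℝ) (hm : 0 < m) (v ω : EuclideanSpace ℝ (Fin 3)) (hω : ‖ω‖ = 1)
    (v0 : ℝ) (hv0 : v0 = Real.sqrt (m ^ 2 + ‖v‖ ^ 2))
    (vhat : EuclideanSpace ℝ (Fin 3)) (hvhat : vhat = v0⁻¹ • v) :
    ‖ω - (⟪vhat, ω⟫ / (1 + ⟪vhat, ω⟫)) • (ω + vhat)‖ ≤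
      2 * Real.sqrt (m ^ 2 + ‖v‖ ^ 2) / m := by
  have hP : 0 < m ^ 2 + ‖v‖ ^ 2 := by positivity
  have hv0pos : 0 < v0 := by rw [hv0]; exact Real.sqrt_pos.mpr hP
  have hv0sq : v0 ^ 2 = m ^ 2 + ‖v‖ ^ 2 := by rw [hv0]; exact Real.sq_sqrt hP.le
  rw [← hv0]
  have hs : v0 ^ 2 * (1 - ‖vhat‖ ^ 2) = m ^ 2 := by
    have h1 : ‖vhat‖ = v0⁻¹ * ‖v‖ := by
      rw [hvhat, norm_smul, Real.norm_of_nonneg (inv_nonneg.mpr hv0pos.le)]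
    have h2 : v0 * ‖vhat‖ = ‖v‖ := by rw [h1]; field_simp
    have h3 : v0 ^ 2 * ‖vhat‖ ^ 2 = ‖v‖ ^ 2 := by rw [← h2]; ring
    linarith
  have hcs : |⟪vhat, ω⟫| ≤ ‖vhat‖ := by
    have := abs_real_inner_le_norm vhat ω
    rwa [hω, mul_one] at this
  have hnsq : ‖ω - ⟪vhat, ω⟫ • vhat‖ ^ 2
      = 1 - 2 * ⟪vhat, ω⟫ ^ 2 + ⟪vhat, ω⟫ ^ 2 * ‖vhat‖ ^ 2 := by
    rw [norm_sub_sq_real, hω, inner_smul_right, real_inner_comm, norm_smul, mul_pow,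
      Real.norm_eq_abs, sq_abs]
    ring
  generalize ha : ⟪vhat, ω⟫ = a at *
  have htpos : 0 < 1 - ‖vhat‖ ^ 2 := by
    by_contra h
    have : v0 ^ 2 * (1 - ‖vhat‖ ^ 2) ≤ 0 :=
      mul_nonpos_of_nonneg_of_nonpos (by positivity) (not_lt.mp h)
    have : 0 < m ^ 2 := by positivity
    linarith
  have hn1 : ‖vhat‖ < 1 := by nlinarith [norm_nonneg vhat]
  have ha1 := abs_lt.mp (lt_of_le_of_lt hcs hn1)
  have hasq : a ^ 2 ≤ ‖vhat‖ ^ 2 := by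
    rw [← sq_abs a]; exact pow_le_pow_left₀ (abs_nonneg _) hcs 2
  have hpos : 0 < 1 + a := by linarith [ha1.1]
  have hw : ω - (a / (1 + a)) • (ω + vhat) = (1 + a)⁻¹ • (ω - a • vhat) := by
    have e : (1 : ℝ) - a / (1 + a) = (1 + a)⁻¹ := by field_simp; ring
    have e2 : ω - (a / (1 + a)) • (ω + vhat)
        = (1 - a / (1 + a)) • ω - (a / (1 + a)) • vhat := by module
    rw [e2, e, smul_sub, smul_smul, div_eq_inv_mul]
  rw [hw, norm_smul, Real.norm_of_nonneg (inv_nonneg.mpr hpos.le), inv_mul_le_iff₀ hpos,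
    mul_div_assoc', le_div_iff₀ hm]
  refine (sq_le_sq₀ (by positivity) (by positivity)).mp ?_
  rw [mul_pow, hnsq, ← hs]
  have hk : (1 - 2 * a ^ 2 + a ^ 2 * ‖vhat‖ ^ 2) * (1 - ‖vhat‖ ^ 2) ≤ 4 * (1 + a) ^ 2 := by
    generalize ‖vhat‖ ^ 2 = s at *
    have k1 : (1 - 2 * a ^ 2 + a ^ 2 * s) * (1 - s) ≤ (1 - a ^ 2) * (1 - s) :=
      mul_le_mul_of_nonneg_right (by nlinarith [sq_nonneg a]) htpos.le
    have k2 : (1 - a ^ 2) * (1 - s) ≤ (1 - a ^ 2) * (1 - a ^ 2) :=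
      mul_le_mul_of_nonneg_left (by linarith) (by linarith)
    have k3 : (1 - a) ^ 2 ≤ 4 := by nlinarith [ha1.1, ha1.2]
    have k4 : (1 + a) ^ 2 * (1 - a) ^ 2 ≤ (1 + a) ^ 2 * 4 :=
      mul_le_mul_of_nonneg_left k3 (by positivity)
    nlinarith
  have := mul_le_mul_of_nonneg_left hk (sq_nonneg v0)
  nlinarith
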